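/- Let M be a countable transitive set with (M,∈) ⊨ ZF, let ⟨P,≼,𝟙⟩ ∈ M be a forcing notion, and let G be an M-generic filter on P. Then the generic extension M[G] is a countable transitive set, M ⊆ M[G], G ∈ M[G], and M[G] contains exactly the same ordinals as M (for every ordinal α, α ∈ M iff α ∈ M[G]). -/

import Mathlib

namespace CtmForcing

open FirstOrder FirstOrder.Language

/-! ### The first-order language of set theory -/

/-- The relation symbols of the language of set theory: a single binary relation `∈`. -/
inductive memRel : ℕ → Type
  | mem : memRel 2

/-- The first-order language `L` of set theory, with a single binary relation symbol `∈`. -/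
def SetLang : Language := ⟨fun _ => Empty, memRel⟩

/-- The membership relation symbol. -/
abbrev memSymb : SetLang.Relations 2 := .mem

/-- `L`-formulas (with no free "unbounded" variables) whose free variables are among
`v₀, …, v_{n-1}`. -/
abbrev BF (n : ℕ) := SetLang.BoundedFormula Empty n

/-- The atomic formula `vᵢ ∈ vⱼ`. -/
def memf {n : ℕ} (i j : Fin n) : BF n :=
  memSymb.boundedFormula₂ (Term.var (Sum.inr i)) (Term.var (Sum.inr j))

/-- The atomic formula `vᵢ = vⱼ`. -/
def eqf {n : ℕ} (i j : Fin n) : BF n :=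
  Term.bdEqual (Term.var (Sum.inr i)) (Term.var (Sum.inr j))

/-- Rename the free variables of a formula along `f`. -/
def reindex {m k : ℕ} (f : Fin m → Fin k) (φ : BF m) : BF k :=
  (BoundedFormula.relabel (Sum.map id f) φ.toFormula : SetLang.BoundedFormula Empty (k + 0))

/-- Conjunction. -/
def andF {n : ℕ} (φ ψ : BF n) : BF n := (φ.imp ψ.not).not

/-- Disjunction. -/
def orF {n : ℕ} (φ ψ : BF n) : BF n := (φ.not).imp ψ

/-- Biimplication. -/
def iffF {n : ℕ} (φ ψ : BF n) : BF n := andF (φ.imp ψ) (ψ.imp φ)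

/-! ### Basic set-theoretic formulas -/

/-- `v₀ ⊆ v₁`. -/
def subF : BF 2 := ((memf 2 0).imp (memf 2 1)).all

/-- `v₀ = ∅`. -/
def emptyF : BF 1 := ((memf 1 0).not).all

/-- `v₂ = {v₀, v₁}`. -/
def pairSetF : BF 3 := (iffF (memf 3 2) (orF (eqf 3 0) (eqf 3 1))).all

/-- `v₁ = {v₀}`. -/
def singF : BF 2 := reindex ![0, 0, 1] pairSetF

/-- `v₂ = ⟨v₀, v₁⟩` (Kuratowski ordered pair). -/
def opF : BF 3 :=
  (iffF (memf 3 2) (orF (reindex ![0, 3] singF) (reindex ![0, 1, 3] pairSetF))).all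

/-- `v₁ = v₀ ∪ {v₀}`. -/
def succF : BF 2 := (iffF (memf 2 1) (orF (memf 2 0) (eqf 2 0))).all

/-- `v₀` is transitive. -/
def transF : BF 1 := ((memf 1 0).imp (reindex ![1, 0] subF)).all

/-- `v₀` is an ordinal (a transitive set of transitive sets). -/
def ordF : BF 1 := andF transF (((memf 1 0).imp (reindex ![1] transF)).all)

/-- `⟨v₀, v₁⟩ ∈ v₂`. -/
def relMemF : BF 3 := (andF (reindex ![0, 1, 3] opF) (memf 3 2)).ex

/-- `v₂` is a function with domain `v₀` mapping onto `v₁` (a surjection from `v₀` onto `v₁`). -/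
def isFuncF : BF 3 :=
  andF
    (andF
      -- v₂ ⊆ v₀ × v₁
      (((memf 3 2).imp
        (((andF (andF (memf 4 0) (memf 5 1)) (reindex ![4, 5, 3] opF)).ex).ex)).all)
      -- total on v₀
      (((memf 3 0).imp ((andF (memf 4 1) (reindex ![3, 4, 2] relMemF)).ex)).all))
    (andF
      -- functional
      ((((andF (reindex ![3, 4, 2] relMemF) (reindex ![3, 5, 2] relMemF)).imp
          (eqf 4 5)).all).all.all)
      -- onto v₁
      (((memf 3 1).imp ((andF (memf 4 0) (reindex ![4, 3, 2] relMemF)).ex)).all))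

/-- `v₂` is injective (as a set of ordered pairs). -/
def injF : BF 3 :=
  ((((andF (reindex ![3, 5, 2] relMemF) (reindex ![4, 5, 2] relMemF)).imp
      (eqf 3 4)).all).all).all

/-- `v₂` is a bijection from `v₀` onto `v₁`. -/
def bijF : BF 3 := andF isFuncF injF

/-! ### The axioms of set theory as `L`-sentences -/

/-- Extensionality. -/
def extAx : SetLang.Sentence :=
  ((((andF subF (reindex ![1, 0] subF)).imp (eqf 0 1)).all).all : BF 0)

/-- Foundation. -/
def foundAx : SetLang.Sentence :=
  (((((memf 1 0).ex).imp
    ((andF (memf 1 0) (((memf 2 0).imp ((memf 2 1).not)).all)).ex)).all) : BF 0)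

/-- Pairing. -/
def pairAx : SetLang.Sentence := (((pairSetF.ex).all).all : BF 0)

/-- Union. -/
def unionAx : SetLang.Sentence :=
  (((((iffF (memf 2 1) ((andF (memf 3 0) (memf 2 3)).ex)).all).ex).all : BF 0))

/-- Powerset. -/
def powF : BF 2 := (iffF (memf 2 1) (reindex ![2, 0] subF)).all

/-- Powerset axiom. -/
def powAx : SetLang.Sentence := (((powF.ex).all) : BF 0)

/-- Infinity. -/
def infAx : SetLang.Sentence :=
  (((andF ((andF (memf 1 0) (reindex ![1] emptyF)).ex)
    (((memf 1 0).imp ((andF (memf 2 0) (reindex ![1, 2] succF)).ex)).all)).ex) : BF 0)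

/-- The instance of the Separation scheme given by `φ`, whose free variables are among
`v₀, …, vₙ`: the parameters are `v₀, …, v_{n-1}` and the tested element is `vₙ`.  It is the
universal closure of `∀A ∃B ∀x (x ∈ B ↔ x ∈ A ∧ φ(params, x))`. -/
def sepAx {n : ℕ} (φ : BF (n + 1)) : SetLang.Sentence :=
  -- context `n+3`: parameters `0,…,n-1`, `A = n`, `B = n+1`, `x = n+2`
  let A : Fin (n + 3) := ⟨n, by omega⟩
  let B : Fin (n + 3) := ⟨n + 1, by omega⟩
  let x : Fin (n + 3) := ⟨n + 2, by omega⟩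
  let φ' : BF (n + 3) := reindex (fun i => if h : (i : ℕ) < n then ⟨i, by omega⟩ else x) φ
  ((((iffF (memf x B) (andF (memf x A) φ')).all).ex).all).alls

/-- The instance of the Replacement scheme given by `φ`, whose free variables are among
`v₀, …, v_{n+1}`: the parameters are `v₀, …, v_{n-1}`, the argument is `x = vₙ`, and the
value is `y = v_{n+1}`.  It is the universal closure of
`∀A [(∀x∈A ∀y ∀y' (φ(x,y) ∧ φ(x,y') → y = y')) → ∃B ∀y (y ∈ B ↔ ∃x∈A φ(x,y))]`. -/
def replAx {n : ℕ} (φ : BF (n + 2)) : SetLang.Sentence :=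
  -- functionality context `n+4`: parameters, `A = n`, `x = n+1`, `y = n+2`, `y' = n+3`
  let A : Fin (n + 4) := ⟨n, by omega⟩
  let x : Fin (n + 4) := ⟨n + 1, by omega⟩
  let y : Fin (n + 4) := ⟨n + 2, by omega⟩
  let y' : Fin (n + 4) := ⟨n + 3, by omega⟩
  let φ₁ : BF (n + 4) :=
    reindex (fun i => if h : (i : ℕ) < n then ⟨i, by omega⟩ else if (i : ℕ) = n then x else y) φ
  let φ₂ : BF (n + 4) :=
    reindex (fun i => if h : (i : ℕ) < n then ⟨i, by omega⟩ else if (i : ℕ) = n then x else y') φ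
  let funcl : BF (n + 1) :=
    ((((andF (memf x A) (andF φ₁ φ₂)).imp (eqf y y')).all).all).all
  -- image context `n+4`: parameters, `A = n`, `B = n+1`, `y = n+2`, `x = n+3`
  let xi : Fin (n + 4) := ⟨n + 3, by omega⟩
  let yi : Fin (n + 4) := ⟨n + 2, by omega⟩
  let B3 : Fin (n + 3) := ⟨n + 1, by omega⟩
  let y3 : Fin (n + 3) := ⟨n + 2, by omega⟩
  let φ₃ : BF (n + 4) :=
    reindex (fun i => if h : (i : ℕ) < n then ⟨i, by omega⟩ else if (i : ℕ) = n then xi else yi) φ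
  let image : BF (n + 1) :=
    (((iffF (memf y3 B3) ((andF (memf xi A) φ₃).ex)).all).ex)
  ((funcl.imp image).all).alls

/-- The Axiom of Choice: every set is the surjective image of an ordinal. -/
def acAx : SetLang.Sentence :=
  ((((andF (reindex ![1] ordF) (reindex ![1, 0, 2] isFuncF)).ex).ex).all : BF 0)

/-- `v₀ = ω`: `v₀` is an ordinal containing `∅`, closed under successors, each of whose
elements is `∅` or a successor. -/
def omegaF : BF 1 :=
  andF (andF ordF ((andF (memf 1 0) (reindex ![1] emptyF)).ex))
    (andF (((memf 1 0).imp ((andF (memf 2 0) (reindex ![1, 2] succF)).ex)).all)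
      (((memf 1 0).imp
        (orF (reindex ![1] emptyF) ((andF (memf 2 1) (reindex ![2, 1] succF)).ex))).all))

/-- Given `v₀ = ω`, `v₁ = ℵ₁`: `v₁` is an ordinal, there is no surjection from `ω` onto `v₁`,
and every element of `v₁` is empty or a surjective image of `ω`. -/
def alephOneF : BF 2 :=
  andF (andF (reindex ![1] ordF) (((reindex ![0, 1, 2] isFuncF).ex).not))
    (((memf 2 1).imp (orF (reindex ![2] emptyF) ((reindex ![0, 2, 3] isFuncF).ex))).all)

/-- The Continuum Hypothesis `ℵ₁ = 2^ℵ₀`: there is a bijection between `𝒫(ω)` and `ℵ₁`. -/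
def chSent : SetLang.Sentence :=
  (((((andF (andF (reindex ![0] omegaF) (reindex ![0, 1] powF))
      (andF (reindex ![0, 2] alephOneF) (reindex ![1, 2, 3] bijF))).ex).ex).ex).ex : BF 0)

/-! ### The theories `Z`, `ZF`, `ZC`, `ZFC` -/

/-- The finitely many non-scheme axioms of `ZF`. -/
def zfFin : SetLang.Theory := {extAx, foundAx, pairAx, unionAx, powAx, infAx}

/-- All instances of the Separation scheme. -/
def sepScheme : SetLang.Theory := Set.range fun p : Σ n, BF (n + 1) => sepAx p.2

/-- All instances of the Replacement scheme. -/
def replScheme : SetLang.Theory := Set.range fun p : Σ n, BF (n + 2) => replAx p.2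

/-- Zermelo set theory. -/
def Z : SetLang.Theory := zfFin ∪ sepScheme

/-- Zermelo–Fraenkel set theory. -/
def ZF : SetLang.Theory := Z ∪ replScheme

/-- Zermelo set theory with Choice. -/
def ZC : SetLang.Theory := Z ∪ {acAx}

/-- Zermelo–Fraenkel set theory with Choice. -/
def ZFC : SetLang.Theory := ZF ∪ {acAx}

/-! ### Satisfaction in a set with the true membership relation -/

/-- The `L`-structure on (the elements of) a `ZFSet` `M`, with `∈` interpreted as true
membership. -/
def zfStruct (M : ZFSet) : SetLang.Structure {x : ZFSet // x ∈ M} where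
  funMap := fun f _ => f.elim
  RelMap | .mem => fun v => ((v 0 : {x : ZFSet // x ∈ M}) : ZFSet) ∈ ((v 1 : {x : ZFSet // x ∈ M}) : ZFSet)

/-- `(M, ∈) ⊨ T`: the structure on `M` with true membership satisfies every sentence of `T`. -/
def ZModels (M : ZFSet) (T : SetLang.Theory) : Prop :=
  ∀ φ ∈ T, letI := zfStruct M; Sentence.Realize (M := {x : ZFSet // x ∈ M}) φ

/-- `(M, ∈) ⊨ φ[v₀, …, v_{k-1}]`: satisfaction of the formula `φ` in `M`, with the
(membership-checked) valuation `v` of its free variables. -/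
def ZRealize (M : ZFSet) {k : ℕ} (φ : BF k) (v : Fin k → ZFSet) : Prop :=
  ∀ h : ∀ i, v i ∈ M,
    letI := zfStruct M
    BoundedFormula.Realize (M := {x : ZFSet // x ∈ M}) φ (fun e => e.elim) (fun i => ⟨v i, h i⟩)

/-- `x` is a (von Neumann) ordinal: a transitive set of transitive sets. -/
def IsOrd (x : ZFSet) : Prop := x.IsTransitive ∧ ∀ y ∈ x, ZFSet.IsTransitive y


/-! ### Forcing: names, values, generic extensions -/

/-- The value `val(G, τ)` of a name `τ` under `G`, defined by `∈`-recursion: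
`val(G, τ) = { val(G, σ) : ∃ p ∈ G, ⟨σ, p⟩ ∈ τ }`. -/
noncomputable def zval (G : ZFSet) : ZFSet → ZFSet :=
  (InvImage.wf ZFSet.rank Ordinal.lt_wf).fix fun τ ih =>
    letI : ∀ (n : ℕ) (f : (Fin n → ZFSet) → ZFSet), ZFSet.Definable n f := fun _ _ => Classical.allZFSetDefinable _
    ZFSet.image (fun σ => if h : ZFSet.rank σ < ZFSet.rank τ then ih σ h else ∅)
      (ZFSet.sep (fun σ => ∃ p ∈ G, ZFSet.pair σ p ∈ τ) (ZFSet.sUnion (ZFSet.sUnion τ)))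

/-- The generic extension `M[G] = { val(G, τ) : τ ∈ M }`. -/
noncomputable def genExt (M G : ZFSet) : ZFSet :=
  letI : ∀ (n : ℕ) (f : (Fin n → ZFSet) → ZFSet), ZFSet.Definable n f := fun _ _ => Classical.allZFSetDefinable _
  ZFSet.image (zval G) M

/-- `⟨P, r, one⟩` is a forcing notion belonging to `M`: `r ∈ M` is (the graph of) a preorder
on `P ∈ M` with greatest element `one`. -/
def ForcingNotion (M P r one : ZFSet) : Prop :=
  P ∈ M ∧ r ∈ M ∧ one ∈ P ∧
    (∀ q ∈ r, ∃ a ∈ P, ∃ b ∈ P, q = ZFSet.pair a b) ∧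
    (∀ p ∈ P, ZFSet.pair p p ∈ r) ∧
    (∀ p ∈ P, ∀ q ∈ P, ∀ s ∈ P, ZFSet.pair p q ∈ r → ZFSet.pair q s ∈ r →
      ZFSet.pair p s ∈ r) ∧
    (∀ p ∈ P, ZFSet.pair p one ∈ r)

/-- `D` is a dense subset of the forcing notion `⟨P, r⟩`. -/
def IsDenseIn (r P D : ZFSet) : Prop :=
  D ⊆ P ∧ ∀ p ∈ P, ∃ d ∈ D, ZFSet.pair d p ∈ r

/-- `G` is a filter on `⟨P, r⟩`: upward closed and downward directed. -/
def IsFilterOn (r P G : ZFSet) : Prop :=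
  G ⊆ P ∧ (∀ x ∈ G, ∀ y ∈ P, ZFSet.pair x y ∈ r → y ∈ G) ∧
    (∀ x ∈ G, ∀ y ∈ G, ∃ z ∈ G, ZFSet.pair z x ∈ r ∧ ZFSet.pair z y ∈ r)

/-- `G` is an `M`-generic filter on `⟨P, r⟩`: a filter meeting every dense subset of `P`
that belongs to `M`. -/
def IsGeneric (M r P G : ZFSet) : Prop :=
  IsFilterOn r P G ∧ ∀ D ∈ M, IsDenseIn r P D → ∃ q ∈ G, q ∈ D


section helpers

set_option linter.style.haveILetI false

universe u
variable {M : ZFSet.{u}}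

/-- Elements of `M`. -/
abbrev Ms (M : ZFSet.{u}) : Type (u + 1) := {x : ZFSet.{u} // x ∈ M}

/-- Parameter-free definability over `(M, ∈)`. -/
def Dfn {n : ℕ} (S : (Fin n → Ms M) → Prop) : Prop :=
  ∃ φ : BF n, ∀ v, letI := zfStruct M
    (BoundedFormula.Realize (M := Ms M) φ default v ↔ S v)

theorem realize_memf {n : ℕ} (i j : Fin n) (e : Empty → Ms M) (v : Fin n → Ms M) :
    letI := zfStruct M
    ((memf i j).Realize e v ↔ (v i).1 ∈ (v j).1) := by
  letI := zfStruct M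
  unfold memf
  rw [BoundedFormula.realize_rel₂]
  rfl

theorem realize_eqf {n : ℕ} (i j : Fin n) (e : Empty → Ms M) (v : Fin n → Ms M) :
    letI := zfStruct M
    ((eqf i j).Realize e v ↔ v i = v j) := by
  letI := zfStruct M
  unfold eqf
  rw [BoundedFormula.realize_bdEqual]
  rfl

theorem realize_andF {n : ℕ} (φ ψ : BF n) (e : Empty → Ms M) (v : Fin n → Ms M) :
    letI := zfStruct M
    ((andF φ ψ).Realize e v ↔ φ.Realize e v ∧ ψ.Realize e v) := by
  letI := zfStruct M
  simp [andF]

theorem realize_orF {n : ℕ} (φ ψ : BF n) (e : Empty → Ms M) (v : Fin n → Ms M) :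
    letI := zfStruct M
    ((orF φ ψ).Realize e v ↔ φ.Realize e v ∨ ψ.Realize e v) := by
  letI := zfStruct M
  simp [orF, or_iff_not_imp_left]

theorem realize_iffF {n : ℕ} (φ ψ : BF n) (e : Empty → Ms M) (v : Fin n → Ms M) :
    letI := zfStruct M
    ((iffF φ ψ).Realize e v ↔ (φ.Realize e v ↔ ψ.Realize e v)) := by
  letI := zfStruct M
  simp only [iffF, realize_andF, BoundedFormula.realize_imp]
  tauto

theorem realize_reindex {m k : ℕ} (f : Fin m → Fin k) (φ : BF m) (e : Empty → Ms M)
    (v : Fin k → Ms M) :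
    letI := zfStruct M
    ((reindex f φ).Realize e v ↔ φ.Realize e (v ∘ f)) := by
  letI := zfStruct M
  unfold reindex
  have := BoundedFormula.realize_relabel (L := SetLang) (M := Ms M) (m := k) (n := 0)
    (φ := φ.toFormula) (g := Sum.map id f) (v := e) (xs := v)
  refine this.trans ?_
  have h2 := BoundedFormula.realize_toFormula (L := SetLang) (M := Ms M) φ
    (Sum.elim e (v ∘ Fin.castAdd 0) ∘ Sum.map id f)
  rw [Formula.Realize] at h2
  have h3 : (v ∘ Fin.natAdd k : Fin 0 → Ms M) = default := Subsingleton.elim _ _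
  rw [h3]
  exact h2

theorem Dfn.mem {n : ℕ} (i j : Fin n) : Dfn (fun v : Fin n → Ms M => (v i).1 ∈ (v j).1) :=
  ⟨memf i j, fun v => realize_memf i j _ v⟩

theorem Dfn.eq {n : ℕ} (i j : Fin n) : Dfn (fun v : Fin n → Ms M => v i = v j) :=
  ⟨eqf i j, fun v => realize_eqf i j _ v⟩

theorem Dfn.and {n : ℕ} {S T : (Fin n → Ms M) → Prop} (hS : Dfn S) (hT : Dfn T) :
    Dfn (fun v => S v ∧ T v) := by
  obtain ⟨φ, hφ⟩ := hS
  obtain ⟨ψ, hψ⟩ := hT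
  exact ⟨andF φ ψ, fun v => by rw [realize_andF, hφ, hψ]⟩

theorem Dfn.or {n : ℕ} {S T : (Fin n → Ms M) → Prop} (hS : Dfn S) (hT : Dfn T) :
    Dfn (fun v => S v ∨ T v) := by
  obtain ⟨φ, hφ⟩ := hS
  obtain ⟨ψ, hψ⟩ := hT
  exact ⟨orF φ ψ, fun v => by rw [realize_orF, hφ, hψ]⟩

theorem Dfn.iff {n : ℕ} {S T : (Fin n → Ms M) → Prop} (hS : Dfn S) (hT : Dfn T) :
    Dfn (fun v => S v ↔ T v) := by
  obtain ⟨φ, hφ⟩ := hS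
  obtain ⟨ψ, hψ⟩ := hT
  exact ⟨iffF φ ψ, fun v => by rw [realize_iffF, hφ, hψ]⟩

theorem Dfn.imp {n : ℕ} {S T : (Fin n → Ms M) → Prop} (hS : Dfn S) (hT : Dfn T) :
    Dfn (fun v => S v → T v) := by
  obtain ⟨φ, hφ⟩ := hS
  obtain ⟨ψ, hψ⟩ := hT
  exact ⟨φ.imp ψ, fun v => by
    letI := zfStruct M
    rw [BoundedFormula.realize_imp, hφ, hψ]⟩

theorem Dfn.ex {n : ℕ} {S : (Fin n → Ms M) → Ms M → Prop}
    (hS : Dfn (fun w : Fin (n + 1) → Ms M => S (fun i => w i.castSucc) (w (Fin.last n)))) :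
    Dfn (fun v => ∃ x, S v x) := by
  obtain ⟨φ, hφ⟩ := hS
  letI := zfStruct M
  refine ⟨φ.ex, fun v => ?_⟩
  rw [BoundedFormula.realize_ex]
  refine exists_congr fun a => ?_
  rw [hφ]
  simp

theorem Dfn.all {n : ℕ} {S : (Fin n → Ms M) → Ms M → Prop}
    (hS : Dfn (fun w : Fin (n + 1) → Ms M => S (fun i => w i.castSucc) (w (Fin.last n)))) :
    Dfn (fun v => ∀ x, S v x) := by
  obtain ⟨φ, hφ⟩ := hS
  letI := zfStruct M
  refine ⟨φ.all, fun v => ?_⟩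
  rw [BoundedFormula.realize_all]
  refine forall_congr' fun a => ?_
  rw [hφ]
  simp

theorem Dfn.congr {n : ℕ} {S T : (Fin n → Ms M) → Prop} (hS : Dfn S) (h : ∀ v, T v ↔ S v) :
    Dfn T := by
  have : T = S := funext fun v => propext (h v)
  rwa [this]

theorem repl2 (hmodel : ZModels M ZF) (R : Ms M → Ms M → Ms M → Ms M → Prop)
    (hR : Dfn (fun v : Fin 4 → Ms M => R (v 0) (v 1) (v 2) (v 3)))
    (p q A : Ms M)
    (hf : ∀ x y y' : Ms M, x.1 ∈ A.1 → R p q x y → R p q x y' → y = y') :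
    ∃ B : Ms M, ∀ y : Ms M, y.1 ∈ B.1 ↔ ∃ x : Ms M, x.1 ∈ A.1 ∧ R p q x y := by
  letI := zfStruct M
  obtain ⟨φ, hφ⟩ := hR
  have h := hmodel (replAx (n := 2) φ) (Or.inr ⟨⟨2, φ⟩, rfl⟩)
  unfold Sentence.Realize Formula.Realize replAx at h
  have h1 := BoundedFormula.realize_alls.1 h ![p, q]
  rw [BoundedFormula.realize_all] at h1
  have h2 := h1 A
  rw [BoundedFormula.realize_imp] at h2
  have h3 := h2 (by
    simp only [BoundedFormula.realize_all, BoundedFormula.realize_imp, realize_andF,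
      realize_memf, realize_eqf, realize_reindex]
    rintro x y y' ⟨hx, h1, h2⟩
    exact hf x y y' hx ((hφ _).1 h1) ((hφ _).1 h2))
  rw [BoundedFormula.realize_ex] at h3
  obtain ⟨B, hB⟩ := h3
  simp only [BoundedFormula.realize_all, realize_andF, realize_iffF, BoundedFormula.realize_ex,
      realize_memf, realize_reindex] at hB
  refine ⟨B, fun y => (hB y).trans (exists_congr fun x => and_congr Iff.rfl ?_)⟩
  exact hφ _

theorem pair_closed (htrans : M.IsTransitive) (hmodel : ZModels M ZF) {a b : ZFSet.{u}}
    (ha : a ∈ M) (hb : b ∈ M) : ({a, b} : ZFSet.{u}) ∈ M := by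
  letI := zfStruct M
  have h := hmodel pairAx (Or.inl (Or.inl (by simp [zfFin])))
  unfold Sentence.Realize Formula.Realize pairAx at h
  have h1 := h ⟨a, ha⟩ ⟨b, hb⟩
  rw [BoundedFormula.realize_ex] at h1
  obtain ⟨c, hc⟩ := h1
  simp only [pairSetF, BoundedFormula.realize_all, realize_iffF, realize_orF, realize_memf,
    realize_eqf] at hc
  have : ({a, b} : ZFSet.{u}) = c.1 := by
    ext y
    rw [ZFSet.mem_pair]
    constructor
    · rintro (rfl | rfl)
      · exact (hc ⟨_, ha⟩).2 (Or.inl rfl)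
      · exact (hc ⟨_, hb⟩).2 (Or.inr rfl)
    · intro hy
      rcases (hc ⟨y, htrans _ c.2 hy⟩).1 hy with h | h
      · exact Or.inl (congrArg Subtype.val h)
      · exact Or.inr (congrArg Subtype.val h)
  rw [this]
  exact c.2

theorem union_closed (htrans : M.IsTransitive) (hmodel : ZModels M ZF) {a : ZFSet.{u}}
    (ha : a ∈ M) : (ZFSet.sUnion a : ZFSet.{u}) ∈ M := by
  letI := zfStruct M
  have h := hmodel unionAx (Or.inl (Or.inl (by simp [zfFin])))
  unfold Sentence.Realize Formula.Realize unionAx at h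
  have h1 := h ⟨a, ha⟩
  rw [BoundedFormula.realize_ex] at h1
  obtain ⟨c, hc⟩ := h1
  simp only [BoundedFormula.realize_all, realize_iffF, realize_andF, realize_memf,
    BoundedFormula.realize_ex] at hc
  have : (ZFSet.sUnion a : ZFSet.{u}) = c.1 := by
    ext y
    rw [ZFSet.mem_sUnion]
    constructor
    · rintro ⟨z, hz, hy⟩
      have hzM := htrans _ ha hz
      exact (hc ⟨y, htrans _ hzM hy⟩).2 ⟨⟨z, hzM⟩, hz, hy⟩
    · intro hy
      obtain ⟨z, hz, hy⟩ := (hc ⟨y, htrans _ c.2 hy⟩).1 hy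
      exact ⟨z.1, hz, hy⟩
  rw [this]
  exact c.2

theorem sing_closed (htrans : M.IsTransitive) (hmodel : ZModels M ZF) {a : ZFSet.{u}}
    (ha : a ∈ M) : ({a} : ZFSet.{u}) ∈ M := by
  have := pair_closed htrans hmodel ha ha
  rwa [ZFSet.pair_eq_singleton] at this

theorem opair_closed (htrans : M.IsTransitive) (hmodel : ZModels M ZF) {a b : ZFSet.{u}}
    (ha : a ∈ M) (hb : b ∈ M) : ZFSet.pair a b ∈ M :=
  pair_closed htrans hmodel (sing_closed htrans hmodel ha) (pair_closed htrans hmodel ha hb)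

theorem insert_closed (htrans : M.IsTransitive) (hmodel : ZModels M ZF) {a b : ZFSet.{u}}
    (ha : a ∈ M) (hb : b ∈ M) : (insert a b : ZFSet.{u}) ∈ M := by
  rw [ZFSet.insert_eq, ← ZFSet.sUnion_pair]
  exact union_closed htrans hmodel (pair_closed htrans hmodel (sing_closed htrans hmodel ha) hb)

theorem opair_mem (htrans : M.IsTransitive) {a b : ZFSet.{u}} (h : ZFSet.pair a b ∈ M) :
    a ∈ M ∧ b ∈ M := by
  have h1 : ({a, b} : ZFSet.{u}) ∈ M := htrans _ h (by simp [ZFSet.pair])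
  exact ⟨htrans _ h1 (by simp), htrans _ h1 (by simp)⟩

theorem Ms_ext (htrans : M.IsTransitive) (a : Ms M) {b : ZFSet.{u}} (hb : b ∈ M) :
    a.1 = b ↔ ∀ z : Ms M, z.1 ∈ a.1 ↔ z.1 ∈ b := by
  constructor
  · intro h z
    rw [h]
  · intro h
    ext z
    exact ⟨fun hz => (h ⟨z, htrans _ a.2 hz⟩).1 hz, fun hz => (h ⟨z, htrans _ hb hz⟩).2 hz⟩

theorem Dfn.upair (htrans : M.IsTransitive) (hmodel : ZModels M ZF) {n : ℕ} (i j k : Fin n) :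
    Dfn (fun v : Fin n → Ms M => (v k).1 = {(v i).1, (v j).1}) := by
  refine Dfn.congr (S := fun v => ∀ z : Ms M, z.1 ∈ (v k).1 ↔ z = v i ∨ z = v j) ?_ ?_
  · exact Dfn.all ((Dfn.mem _ _).iff ((Dfn.eq _ _).or (Dfn.eq _ _)))
  · intro v
    rw [Ms_ext htrans _ (pair_closed htrans hmodel (v i).2 (v j).2)]
    simp only [Subtype.ext_iff, ZFSet.mem_pair]

theorem Dfn.opair (htrans : M.IsTransitive) (hmodel : ZModels M ZF) {n : ℕ} (i j k : Fin n) :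
    Dfn (fun v : Fin n → Ms M => (v k).1 = ZFSet.pair (v i).1 (v j).1) := by
  refine Dfn.congr (S := fun v => ∀ z : Ms M, z.1 ∈ (v k).1 ↔ z.1 = {(v i).1, (v i).1} ∨
    z.1 = {(v i).1, (v j).1}) ?_ ?_
  · exact Dfn.all ((Dfn.mem _ _).iff ((Dfn.upair htrans hmodel _ _ _).or
      (Dfn.upair htrans hmodel _ _ _)))
  · intro v
    rw [Ms_ext htrans _ (opair_closed htrans hmodel (v i).2 (v j).2)]
    simp [ZFSet.pair]

theorem Dfn.opmem (htrans : M.IsTransitive) (hmodel : ZModels M ZF) {n : ℕ} (i j k : Fin n) :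
    Dfn (fun v : Fin n → Ms M => ZFSet.pair (v i).1 (v j).1 ∈ (v k).1) := by
  refine Dfn.congr (S := fun v => ∃ z : Ms M, z.1 = ZFSet.pair (v i).1 (v j).1 ∧
    z.1 ∈ (v k).1) ?_ ?_
  · exact Dfn.ex ((Dfn.opair htrans hmodel _ _ _).and (Dfn.mem _ _))
  · intro v
    constructor
    · intro h
      exact ⟨⟨_, htrans _ (v k).2 h⟩, rfl, h⟩
    · rintro ⟨z, hz, h⟩
      rwa [← hz]

/-- `F` is a partial attempt at the recursion given by `T`. -/
def Good (T : Ms M → Ms M → Ms M → Prop) (p F : Ms M) : Prop :=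
  ∀ a b : Ms M, ZFSet.pair a.1 b.1 ∈ F.1 →
    (∀ x : Ms M, x.1 ∈ a.1 → ∃ c : Ms M, ZFSet.pair x.1 c.1 ∈ F.1) ∧
    (∀ y : Ms M, y.1 ∈ b.1 ↔ ∃ x c : Ms M, x.1 ∈ a.1 ∧ ZFSet.pair x.1 c.1 ∈ F.1 ∧ T p c y)

/-- `F` is the least attempt defined at `x`. -/
def Least (T : Ms M → Ms M → Ms M → Prop) (p x F : Ms M) : Prop :=
  (Good T p F ∧ ∃ b : Ms M, ZFSet.pair x.1 b.1 ∈ F.1) ∧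
    ∀ F' : Ms M, (Good T p F' ∧ ∃ b : Ms M, ZFSet.pair x.1 b.1 ∈ F'.1) →
      ∀ z : Ms M, z.1 ∈ F.1 → z.1 ∈ F'.1

theorem Dfn.good (htrans : M.IsTransitive) (hmodel : ZModels M ZF)
    {T : Ms M → Ms M → Ms M → Prop}
    (hT : ∀ (n : ℕ) (i j k : Fin n), Dfn (fun v : Fin n → Ms M => T (v i) (v j) (v k)))
    {n : ℕ} (i j : Fin n) :
    Dfn (fun v : Fin n → Ms M => Good T (v i) (v j)) := by
  unfold Good
  exact Dfn.all (Dfn.all ((Dfn.opmem htrans hmodel _ _ _).imp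
    ((Dfn.all ((Dfn.mem _ _).imp (Dfn.ex (Dfn.opmem htrans hmodel _ _ _)))).and
      (Dfn.all ((Dfn.mem _ _).iff (Dfn.ex (Dfn.ex ((Dfn.mem _ _).and
        ((Dfn.opmem htrans hmodel _ _ _).and (hT _ _ _ _))))))))))

theorem Dfn.least (htrans : M.IsTransitive) (hmodel : ZModels M ZF)
    {T : Ms M → Ms M → Ms M → Prop}
    (hT : ∀ (n : ℕ) (i j k : Fin n), Dfn (fun v : Fin n → Ms M => T (v i) (v j) (v k)))
    {n : ℕ} (i j k : Fin n) :
    Dfn (fun v : Fin n → Ms M => Least T (v i) (v j) (v k)) := by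
  unfold Least
  exact ((Dfn.good htrans hmodel hT _ _).and (Dfn.ex (Dfn.opmem htrans hmodel _ _ _))).and
    (Dfn.all (((Dfn.good htrans hmodel hT _ _).and (Dfn.ex (Dfn.opmem htrans hmodel _ _ _))).imp
      (Dfn.all ((Dfn.mem _ _).imp (Dfn.mem _ _)))))

section recursion

variable (htrans : M.IsTransitive) (hmodel : ZModels M ZF)
  {T : Ms M → Ms M → Ms M → Prop}
  (hT : ∀ (n : ℕ) (i j k : Fin n), Dfn (fun v : Fin n → Ms M => T (v i) (v j) (v k)))
  (p : Ms M) (t g : ZFSet.{u} → ZFSet.{u})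
  (hTt : ∀ c y : Ms M, T p c y ↔ y.1 ∈ t c.1)
  (ht : ∀ c ∈ M, t c ∈ M)
  (hg : ∀ a y, y ∈ g a ↔ ∃ x ∈ a, y ∈ t (g x))

include htrans hTt ht hg

theorem good_val {F : Ms M} (hF : Good T p F) (a : ZFSet.{u}) :
    ∀ b, ZFSet.pair a b ∈ F.1 → b = g a := by
  induction a using ZFSet.inductionOn with
  | h a ih =>
  intro b hab
  obtain ⟨ha, hb⟩ := opair_mem htrans (htrans _ F.2 hab)
  obtain ⟨h1, h2⟩ := hF ⟨a, ha⟩ ⟨b, hb⟩ hab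
  ext y
  rw [hg]
  constructor
  · intro hy
    obtain ⟨x, c, hx, hxc, hTc⟩ := (h2 ⟨y, htrans _ hb hy⟩).1 hy
    have := ih _ hx _ hxc
    exact ⟨x.1, hx, this ▸ (hTt _ _).1 hTc⟩
  · rintro ⟨x, hx, hy⟩
    obtain ⟨c, hc⟩ := h1 ⟨x, htrans _ ha hx⟩ hx
    have h3 := ih _ hx _ hc
    rw [← h3] at hy
    exact (h2 ⟨y, htrans _ (ht _ c.2) hy⟩).2 ⟨⟨x, htrans _ ha hx⟩, c, hx, hc, (hTt _ _).2 hy⟩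

theorem good_of {F : Ms M} (hF : ∀ a b, ZFSet.pair a b ∈ F.1 →
    b = g a ∧ ∀ x ∈ a, ZFSet.pair x (g x) ∈ F.1) : Good T p F := by
  have key : ∀ a b, ZFSet.pair a b ∈ F.1 → a ∈ M ∧ b ∈ M :=
    fun a b h => opair_mem htrans (htrans _ F.2 h)
  intro a b hab
  obtain ⟨h1, h2⟩ := hF _ _ hab
  refine ⟨fun x hx => ⟨⟨g x.1, (key _ _ (h2 _ hx)).2⟩, h2 _ hx⟩, fun y => ?_⟩
  rw [h1, hg]
  constructor
  · rintro ⟨x, hx, hy⟩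
    obtain ⟨hxM, hgM⟩ := key _ _ (h2 _ hx)
    exact ⟨⟨x, hxM⟩, ⟨g x, hgM⟩, hx, h2 _ hx, (hTt _ _).2 hy⟩
  · rintro ⟨x, c, hx, hxc, hTc⟩
    exact ⟨x.1, hx, (hF _ _ hxc).1 ▸ (hTt _ _).1 hTc⟩

include hmodel in
theorem step_closed (a : ZFSet.{u}) (ha : a ∈ M) (hT : ∀ (n : ℕ) (i j k : Fin n),
      Dfn (fun v : Fin n → Ms M => T (v i) (v j) (v k)))
    (F : Ms M) (hF : ∀ x ∈ a, ∀ b, ZFSet.pair x b ∈ F.1 ↔ b = g x) : g a ∈ M := by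
  have key : ∀ x ∈ a, g x ∈ M := fun x hx =>
    (opair_mem htrans (htrans _ F.2 ((hF x hx _).2 rfl))).2
  obtain ⟨B, hB⟩ := repl2 hmodel
    (fun p F x y => ∃ c : Ms M, ZFSet.pair x.1 c.1 ∈ F.1 ∧ ∀ z : Ms M, z.1 ∈ y.1 ↔ T p c z)
    (Dfn.ex ((Dfn.opmem htrans hmodel _ _ _).and (Dfn.all ((Dfn.mem _ _).iff (hT _ _ _ _)))))
    p F ⟨a, ha⟩ (by
      rintro x y y' hx ⟨c, hc, h⟩ ⟨c', hc', h'⟩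
      have e : c = c' := Subtype.ext (((hF _ hx _).1 hc).trans ((hF _ hx _).1 hc').symm)
      subst e
      exact Subtype.ext ((Ms_ext htrans y y'.2).2 fun z => (h z).trans (h' z).symm))
  have : g a = ZFSet.sUnion B.1 := by
    ext y
    rw [hg, ZFSet.mem_sUnion]
    constructor
    · rintro ⟨x, hx, hy⟩
      refine ⟨t (g x), ?_, hy⟩
      exact (hB ⟨_, ht _ (key x hx)⟩).2 ⟨⟨x, htrans _ ha hx⟩, hx, ⟨g x, key x hx⟩,
        (hF _ hx _).2 rfl, fun z => (hTt ⟨g x, key x hx⟩ z).symm⟩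
    · rintro ⟨z, hz, hy⟩
      have hzM := htrans _ B.2 hz
      obtain ⟨x, hx, c, hc, h⟩ := (hB ⟨z, hzM⟩).1 hz
      refine ⟨x.1, hx, ?_⟩
      have h2 := (hTt _ _).1 ((h ⟨y, htrans _ hzM hy⟩).1 hy)
      rwa [(hF _ hx _).1 hc] at h2
  rw [this]
  exact union_closed htrans hmodel B.2

include hmodel hT in
theorem least_exists (a : ZFSet.{u}) : ∀ ha : a ∈ M, ∃ F : Ms M, Least T p ⟨a, ha⟩ F := by
  have gv := fun {F} hF a => good_val (T := T) htrans p t g hTt ht hg (F := F) hF a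
  induction a using ZFSet.inductionOn with
  | h a ih =>
  intro ha
  obtain ⟨B, hB⟩ := repl2 hmodel (fun p _ x y => Least T p x y)
    (Dfn.least htrans hmodel hT _ _ _) p p ⟨a, ha⟩ (by
      intro x y y' hx h h'
      exact Subtype.ext ((Ms_ext htrans y y'.2).2 fun z => ⟨h.2 _ h'.1 z, h'.2 _ h.1 z⟩))
  have hUM := union_closed htrans hmodel B.2
  -- every member of the union comes from a good piece
  have hU : ∀ z ∈ (ZFSet.sUnion B.1 : ZFSet.{u}), ∃ x : Ms M, x.1 ∈ a ∧ ∃ F : Ms M,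
      Least T p x F ∧ z ∈ F.1 ∧ F.1 ⊆ ZFSet.sUnion B.1 := by
    intro z hz
    obtain ⟨F, hF, hzF⟩ := ZFSet.mem_sUnion.1 hz
    obtain ⟨x, hx, hL⟩ := (hB ⟨F, htrans _ B.2 hF⟩).1 hF
    exact ⟨x, hx, _, hL, hzF, fun w hw => ZFSet.mem_sUnion.2 ⟨F, hF, hw⟩⟩
  have hUg : ∀ c b, ZFSet.pair c b ∈ (ZFSet.sUnion B.1 : ZFSet.{u}) →
      b = g c ∧ ∀ x ∈ c, ZFSet.pair x (g x) ∈ (ZFSet.sUnion B.1 : ZFSet.{u}) := by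
    intro c b hcb
    obtain ⟨x, hx, F, hL, hF, hsub⟩ := hU _ hcb
    refine ⟨gv hL.1.1 _ _ hF, fun w hw => ?_⟩
    obtain ⟨hc, hb⟩ := opair_mem htrans (htrans _ hUM hcb)
    obtain ⟨d, hd⟩ := (hL.1.1 ⟨c, hc⟩ ⟨b, hb⟩ hF).1 ⟨w, htrans _ hc hw⟩ hw
    rw [← gv hL.1.1 _ _ hd]
    exact hsub hd
  have hUa : ∀ x ∈ a, ZFSet.pair x (g x) ∈ (ZFSet.sUnion B.1 : ZFSet.{u}) := by
    intro x hx
    have hxM := htrans _ ha hx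
    obtain ⟨F, hF⟩ := ih x hx hxM
    obtain ⟨b, hb⟩ := hF.1.2
    rw [← gv hF.1.1 _ _ hb]
    exact ZFSet.mem_sUnion.2 ⟨F.1, (hB F).2 ⟨⟨x, hxM⟩, hx, hF⟩, hb⟩
  have hga : g a ∈ M := step_closed htrans hmodel p t g hTt ht hg a ha hT
    ⟨_, hUM⟩ (fun x hx b => ⟨fun h => (hUg _ _ h).1, fun h => h ▸ hUa x hx⟩)
  refine ⟨⟨insert (ZFSet.pair a (g a)) (ZFSet.sUnion B.1),
    insert_closed htrans hmodel (opair_closed htrans hmodel ha hga) hUM⟩, ⟨?_, ⟨g a, hga⟩, ?_⟩, ?_⟩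
  · refine good_of htrans p t g hTt ht hg ?_
    intro c b hcb
    rcases ZFSet.mem_insert_iff.1 hcb with h | h
    · obtain ⟨rfl, rfl⟩ := ZFSet.pair_inj.1 h
      exact ⟨rfl, fun x hx => ZFSet.mem_insert_iff.2 (Or.inr (hUa x hx))⟩
    · obtain ⟨h1, h2⟩ := hUg _ _ h
      exact ⟨h1, fun x hx => ZFSet.mem_insert_iff.2 (Or.inr (h2 x hx))⟩
  · exact ZFSet.mem_insert_iff.2 (Or.inl rfl)
  · rintro F' ⟨hF', b, hb⟩ z hz
    rcases ZFSet.mem_insert_iff.1 hz with h | h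
    · rw [h, ← gv hF' _ _ hb]
      exact hb
    · obtain ⟨x, hx, F, hL, hzF, -⟩ := hU _ h
      obtain ⟨d, hd⟩ := (hF' _ _ hb).1 x hx
      exact hL.2 F' ⟨hF', d, hd⟩ z hzF

include hmodel hT in
theorem rec_main (a : ZFSet.{u}) (ha : a ∈ M) : g a ∈ M ∧
    ∃ F : Ms M, ∀ x ∈ a, ∀ b, ZFSet.pair x b ∈ F.1 ↔ b = g x := by
  obtain ⟨F, ⟨hG, b, hb⟩, -⟩ := least_exists htrans hmodel hT p t g hTt ht hg a ha
  have gv := good_val htrans p t g hTt ht hg hG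
  refine ⟨gv _ _ hb ▸ b.2, F, fun x hx c => ⟨gv _ _, ?_⟩⟩
  rintro rfl
  obtain ⟨d, hd⟩ := (hG _ _ hb).1 ⟨x, htrans _ ha hx⟩ hx
  rw [← gv _ _ hd]
  exact hd

end recursion

/-- Check names. -/
noncomputable def chk (o : ZFSet.{u}) (a : ZFSet.{u}) : ZFSet.{u} :=
  ZFSet.range (fun x : {x // x ∈ a} => ZFSet.pair (chk o x.1) o)
termination_by a
decreasing_by exact x.2

theorem mem_chk (o a y : ZFSet.{u}) : y ∈ chk o a ↔ ∃ x ∈ a, y = ZFSet.pair (chk o x) o := by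
  rw [chk, ZFSet.mem_range]
  constructor
  · rintro ⟨x, rfl⟩
    exact ⟨x.1, x.2, rfl⟩
  · rintro ⟨x, hx, rfl⟩
    exact ⟨⟨x, hx⟩, rfl⟩

theorem mem_zval (G τ y : ZFSet.{u}) :
    y ∈ zval G τ ↔ ∃ σ, ∃ p ∈ G, ZFSet.pair σ p ∈ τ ∧ y = zval G σ := by
  have hr : ∀ σ p, ZFSet.pair σ p ∈ τ → ZFSet.rank σ < ZFSet.rank τ := by
    intro σ p h
    refine lt_trans ?_ (lt_trans (ZFSet.rank_lt_of_mem (y := {σ, p}) ?_) (ZFSet.rank_lt_of_mem h))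
    · exact ZFSet.rank_lt_of_mem (by simp)
    · simp [ZFSet.pair]
  letI : ∀ (n : ℕ) (f : (Fin n → ZFSet.{u}) → ZFSet.{u}), ZFSet.Definable n f :=
    fun _ _ => Classical.allZFSetDefinable _
  unfold zval
  rw [WellFounded.fix_eq, ZFSet.mem_image]
  constructor
  · rintro ⟨σ, hσ, rfl⟩
    obtain ⟨-, p, hp, hpτ⟩ := ZFSet.mem_sep.1 hσ
    refine ⟨σ, p, hp, hpτ, ?_⟩
    rw [dif_pos (hr _ _ hpτ)]
  · rintro ⟨σ, p, hp, hpτ, rfl⟩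
    refine ⟨σ, ZFSet.mem_sep.2 ⟨?_, p, hp, hpτ⟩, ?_⟩
    · refine ZFSet.mem_sUnion.2 ⟨{σ, p}, ZFSet.mem_sUnion.2 ⟨_, hpτ, ?_⟩, ?_⟩
      · simp [ZFSet.pair]
      · simp
    · rw [dif_pos (hr _ _ hpτ)]

theorem mem_genExt (M G y : ZFSet.{u}) : y ∈ genExt M G ↔ ∃ τ ∈ M, zval G τ = y := by
  letI : ∀ (n : ℕ) (f : (Fin n → ZFSet.{u}) → ZFSet.{u}), ZFSet.Definable n f :=
    fun _ _ => Classical.allZFSetDefinable _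
  unfold genExt
  rw [ZFSet.mem_image]

theorem zval_chk {G o : ZFSet.{u}} (ho : o ∈ G) (a : ZFSet.{u}) : zval G (chk o a) = a := by
  induction a using ZFSet.inductionOn with
  | h a ih =>
  ext y
  rw [mem_zval]
  constructor
  · rintro ⟨σ, p, hp, h, rfl⟩
    obtain ⟨x, hx, e⟩ := (mem_chk _ _ _).1 h
    obtain ⟨rfl, rfl⟩ := ZFSet.pair_inj.1 e
    rwa [ih x hx]
  · intro hy
    exact ⟨chk o y, o, ho, (mem_chk _ _ _).2 ⟨y, hy, rfl⟩, (ih y hy).symm⟩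

theorem rank_zval (G τ : ZFSet.{u}) : (zval G τ).rank ≤ τ.rank := by
  induction h : τ.rank using WellFoundedLT.induction generalizing τ with
  | ind o ih =>
  rw [ZFSet.rank_le_iff]
  intro y hy
  obtain ⟨σ, p, hp, hpτ, rfl⟩ := (mem_zval _ _ _).1 hy
  have hr : σ.rank < o := by
    rw [← h]
    refine lt_trans ?_ (lt_trans (ZFSet.rank_lt_of_mem (y := {σ, p}) ?_)
      (ZFSet.rank_lt_of_mem hpτ))
    · exact ZFSet.rank_lt_of_mem (by simp)
    · simp [ZFSet.pair]
  exact lt_of_le_of_lt (ih _ hr σ rfl) hr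

theorem chk_main (htrans : M.IsTransitive) (hmodel : ZModels M ZF) (o : Ms M)
    (a : ZFSet.{u}) (ha : a ∈ M) : chk o.1 a ∈ M ∧
    ∃ F : Ms M, ∀ x ∈ a, ∀ b, ZFSet.pair x b ∈ F.1 ↔ b = chk o.1 x := by
  refine rec_main (T := fun p c y => y.1 = ZFSet.pair c.1 p.1) htrans hmodel
    (fun n i j k => Dfn.opair htrans hmodel _ _ _) o (fun c => {ZFSet.pair c o.1}) (chk o.1)
    (fun c y => by simp)
    (fun c hc => sing_closed htrans hmodel (opair_closed htrans hmodel hc o.2)) ?_ a ha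
  intro a y
  simp [mem_chk]

theorem rank_main (htrans : M.IsTransitive) (hmodel : ZModels M ZF)
    (a : ZFSet.{u}) (ha : a ∈ M) : a.rank.toZFSet ∈ M := by
  refine (rec_main (T := fun _ c y => y = c ∨ y.1 ∈ c.1) htrans hmodel
    (fun n i j k => (Dfn.eq _ _).or (Dfn.mem _ _)) ⟨a, ha⟩ (fun c => insert c c)
    (fun a => a.rank.toZFSet) (fun c y => by simp only [Subtype.ext_iff, ZFSet.mem_insert_iff])
    (fun c hc => insert_closed htrans hmodel hc hc) ?_ a ha).1
  intro a y
  simp only [← Ordinal.toZFSet_add_one, Ordinal.mem_toZFSet_iff, ZFSet.lt_rank_iff]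
  constructor
  · rintro ⟨b, ⟨x, hx, hb⟩, rfl⟩
    exact ⟨x, hx, b, Order.lt_add_one_iff.2 hb, rfl⟩
  · rintro ⟨x, hx, b, hb, rfl⟩
    exact ⟨b, ⟨x, hx, Order.lt_add_one_iff.1 hb⟩, rfl⟩

end helpers

/-- basic properties of the generic extension `M[G]`. -/
theorem genExt_basic (M : ZFSet) (hcount : M.toSet.Countable)
    (htrans : M.IsTransitive) (hmodel : ZModels M ZF)
    (P r one : ZFSet) (hforcing : ForcingNotion M P r one)
    (G : ZFSet) (hG : IsGeneric M r P G) :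
    (genExt M G).toSet.Countable ∧ (genExt M G).IsTransitive ∧
      M ⊆ genExt M G ∧ G ∈ genExt M G ∧
      (∀ α : ZFSet, IsOrd α → (α ∈ M ↔ α ∈ genExt M G)) := by
  obtain ⟨hP, hr, hone, hrP, hrefl, htr, hmax⟩ := hforcing
  obtain ⟨⟨hGP, hup, hdir⟩, hgen⟩ := hG
  have hoM : one ∈ M := htrans _ hP hone
  have hoG : one ∈ G := by
    obtain ⟨q, hq, -⟩ := hgen P hP ⟨fun _ h => h, fun p hp => ⟨p, hp, hrefl p hp⟩⟩
    exact hup q hq one hone (hmax q (hGP hq))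
  have hsub : M ⊆ genExt M G := fun x hx => (mem_genExt _ _ _).2
    ⟨chk one x, (chk_main htrans hmodel ⟨one, hoM⟩ x hx).1, zval_chk hoG x⟩
  refine ⟨?_, ?_, hsub, ?_, ?_⟩
  · refine (hcount.image (zval G)).mono ?_
    intro y hy
    obtain ⟨τ, hτ, rfl⟩ := (mem_genExt _ _ _).1 hy
    exact ⟨τ, hτ, rfl⟩
  · intro y hy z hz
    obtain ⟨τ, hτ, rfl⟩ := (mem_genExt _ _ _).1 hy
    obtain ⟨σ, p, hp, h, rfl⟩ := (mem_zval _ _ _).1 hz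
    exact (mem_genExt _ _ _).2 ⟨σ, (opair_mem htrans (htrans _ hτ h)).1, rfl⟩
  · obtain ⟨-, F, hF⟩ := chk_main htrans hmodel ⟨one, hoM⟩ P hP
    obtain ⟨B, hB⟩ := repl2 hmodel
      (fun F _ x y => ∃ c : Ms M, ZFSet.pair x.1 c.1 ∈ F.1 ∧ y.1 = ZFSet.pair c.1 x.1)
      (Dfn.ex ((Dfn.opmem htrans hmodel _ _ _).and (Dfn.opair htrans hmodel _ _ _)))
      F F ⟨P, hP⟩ (by
        rintro x y y' hx ⟨c, hc, h⟩ ⟨c', hc', h'⟩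
        rw [hF _ hx] at hc hc'
        exact Subtype.ext (by rw [h, h', hc, hc']))
    refine (mem_genExt _ _ _).2 ⟨B.1, B.2, ?_⟩
    ext y
    rw [mem_zval]
    constructor
    · rintro ⟨σ, p, hp, h, rfl⟩
      obtain ⟨x, hx, c, hc, e⟩ := (hB ⟨_, htrans _ B.2 h⟩).1 h
      obtain ⟨rfl, rfl⟩ := ZFSet.pair_inj.1 e
      rw [(hF _ hx _).1 hc, zval_chk hoG]
      exact hp
    · intro hy
      have hyP := hGP hy
      have hyM := htrans _ hP hyP
      have hcM := (chk_main htrans hmodel ⟨one, hoM⟩ y hyM).1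
      refine ⟨chk one y, y, hy, ?_, (zval_chk hoG y).symm⟩
      exact (hB ⟨_, opair_closed htrans hmodel hcM hyM⟩).2
        ⟨⟨y, hyM⟩, hyP, ⟨_, hcM⟩, (hF _ hyP _).2 rfl, rfl⟩
  · intro α hα
    refine ⟨fun h => hsub h, fun h => ?_⟩
    obtain ⟨τ, hτ, hv⟩ := (mem_genExt _ _ _).1 h
    have hα' : α.IsOrdinal := ZFSet.isOrdinal_iff_forall_mem_isTransitive.2 hα
    have hle : α.rank ≤ τ.rank := hv ▸ rank_zval G τ
    have hM := rank_main htrans hmodel τ hτ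
    rw [← hα'.toZFSet_rank_eq]
    rcases hle.eq_or_lt with e | e
    · rwa [e]
    · exact htrans _ hM (Ordinal.toZFSet_mem_toZFSet_iff.2 e)

end CtmForcing
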